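/- For every τ in the upper half plane ℍ, the discriminant Δ(τ) = g₂(τ)³ − 27 g₃(τ)² is nonzero. -/

import Mathlib

/-- A lattice point mτ + n of the lattice L_τ = ℤ + ℤτ, indexed by (m, n) ∈ ℤ × ℤ. -/
noncomputable def latPt (τ : ℂ) (p : ℤ × ℤ) : ℂ := (p.1 : ℂ) * τ + (p.2 : ℂ)

/-- g₂(τ) = 60 Σ_{ω ∈ L_τ, ω ≠ 0} ω⁻⁴. -/
noncomputable def gTwo (τ : ℂ) : ℂ := 60 * ∑' p : {p : ℤ × ℤ // p ≠ 0}, 1 / latPt τ p.1 ^ 4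

/-- g₃(τ) = 140 Σ_{ω ∈ L_τ, ω ≠ 0} ω⁻⁶. -/
noncomputable def gThree (τ : ℂ) : ℂ := 140 * ∑' p : {p : ℤ × ℤ // p ≠ 0}, 1 / latPt τ p.1 ^ 6

open UpperHalfPlane ModularForm EisensteinSeries in
/-- The lattice sum of weight `k` is `2 ζ(k)` times the normalised Eisenstein series. -/
theorem tsum_one_div_latPt_pow_eq {k : ℕ} (hk : 3 ≤ k) (z : ℍ) :
    ∑' p : {p : ℤ × ℤ // p ≠ 0}, 1 / latPt z p.1 ^ k = 2 * riemannZeta k * E hk z := by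
  have hE : E hk z = 1 / 2 * eisensteinSeries (N := 1) 0 k z := rfl
  have hsupp : Function.support (fun p : ℤ × ℤ ↦ 1 / latPt z p ^ k) ⊆ {p | p ≠ 0} := by
    rintro p hp rfl
    simp [latPt, show k ≠ 0 by lia] at hp
  calc ∑' p : {p : ℤ × ℤ // p ≠ 0}, 1 / latPt z p.1 ^ k
      = ∑' p : ℤ × ℤ, 1 / latPt z p ^ k := tsum_subtype_eq_of_support_subset hsupp
    _ = ∑' v : Fin 2 → ℤ, eisSummand k v z := by
      rw [← (finTwoArrowEquiv ℤ).tsum_eq]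
      exact tsum_congr fun v ↦ by simp [latPt, eisSummand]
    _ = 2 * riemannZeta k * E hk z := by
      rw [tsum_eisSummand_eq_riemannZeta_mul_eisensteinSeries hk z, hE]
      ring

theorem riemannZeta_six : riemannZeta 6 = Real.pi ^ 6 / 945 := by
  have h := riemannZeta_two_mul_nat (k := 3) (by norm_num)
  have hb : bernoulli 6 = 1 / 42 := by decide +kernel
  norm_num [hb, Nat.factorial] at h
  rw [h]
  ring

/-- For every τ in the upper half plane, the discriminant Δ(τ) = g₂(τ)³ − 27 g₃(τ)²
is nonzero. -/
theorem discriminant_ne_zero (τ : ℂ) (hτ : 0 < τ.im) :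
    gTwo τ ^ 3 - 27 * gThree τ ^ 2 ≠ 0 := by
  let z : UpperHalfPlane := ⟨τ, hτ⟩
  have h₄ : gTwo τ = 4 / 3 * Real.pi ^ 4 * ModularForm.E₄ z := by
    have h := tsum_one_div_latPt_pow_eq (k := 4) (by norm_num) z
    rw [Nat.cast_ofNat, riemannZeta_four] at h
    rw [gTwo, show τ = (z : ℂ) from rfl, h]
    ring
  have h₆ : gThree τ = 8 / 27 * Real.pi ^ 6 * ModularForm.E₆ z := by
    have h := tsum_one_div_latPt_pow_eq (k := 6) (by norm_num) z
    rw [Nat.cast_ofNat, riemannZeta_six] at h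
    rw [gThree, show τ = (z : ℂ) from rfl, h]
    ring
  have hΔ : gTwo τ ^ 3 - 27 * gThree τ ^ 2 =
      4096 * Real.pi ^ 12 * ModularForm.discriminant z := by
    rw [ModularForm.discriminant_eq_E₄_cube_sub_E₆_sq, h₄, h₆]
    ring
  rw [hΔ]
  have hπ : (Real.pi : ℂ) ≠ 0 := mod_cast Real.pi_ne_zero
  exact mul_ne_zero (by simp [hπ]) (ModularForm.discriminant_ne_zero z)
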